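/- Let $p$ be a prime and let $U, V, W$ be finite-dimensional $\mathbb{F}_p$-vector spaces. There exist absolute constants $C, C' > 0$ such that the following holds. Let $T \colon U \to \mathcal{L}(V, W)$ be a linear map with the property that $\operatorname{rank} T(u) \leq k$ for at least $c|U|$ elements $u \in U$, where $c > 0$ and $k \in \mathbb{N}$. Then, writing $\xi = C(1 + \log c^{-1})^{C'}(1+k)^{C'}(1 + \log p)^{C'}$, there exist subspaces $U' \leq U$, $V' \leq V$ and $E \leq W$ such that $\operatorname{codim}_U U' \leq \exp(\exp(\xi))$, $\operatorname{codim}_V V' \leq \exp(\exp(\xi))$, $\dim E \leq \exp(\exp(\exp(\xi)))$, and $T(u)(v) \in E$ for all $u \in U'$ and $v \in V'$. -/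

import Mathlib

open Module in
theorem lrt_step2 {F U V W : Type} [Field F] [AddCommGroup U] [AddCommGroup V] [AddCommGroup W]
    [Module F U] [Module F V] [Module F W] [FiniteDimensional F U] [FiniteDimensional F V]
    [FiniteDimensional F W] (T : U →ₗ[F] V →ₗ[F] W) (K : ℕ)
    (hK : ∀ u, finrank F (LinearMap.range (T u)) ≤ K) :
    ∃ (U' : Submodule F U) (V' : Submodule F V) (E : Submodule F W),
      finrank F U ≤ finrank F U' + K ^ 2 ∧ finrank F V ≤ finrank F V' + K ∧
      finrank F E ≤ K + K ^ 2 ∧ ∀ u ∈ U', ∀ v ∈ V', T u v ∈ E := by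
  classical
  obtain ⟨u0, hu0⟩ : ∃ u0, ∀ u, finrank F (LinearMap.range (T u)) ≤
      finrank F (LinearMap.range (T u0)) := by
    have hfin : (Set.range fun u => finrank F (LinearMap.range (T u))).Finite :=
      (Set.finite_Iic K).subset (by rintro _ ⟨u, rfl⟩; exact hK u)
    obtain ⟨_, ⟨u0, rfl⟩, h⟩ := Set.exists_max_image _ id hfin ⟨_, ⟨0, rfl⟩⟩
    exact ⟨u0, fun u => h _ ⟨u, rfl⟩⟩
  have hr := hK u0
  set S := T u0 with hS
  set r := finrank F (LinearMap.range S) with hrdef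
  obtain ⟨s, hs⟩ := S.rangeRestrict.exists_rightInverse_of_surjective S.range_rangeRestrict
  obtain ⟨P, hP⟩ := (LinearMap.range S).subtype.exists_leftInverse_of_injective
    (Submodule.ker_subtype _)
  have hs' : ∀ y, S (s y) = y := fun y => congrArg Subtype.val (LinearMap.congr_fun hs y)
  have hP' : ∀ y : LinearMap.range S, P y = y := fun y => LinearMap.congr_fun hP y
  let Φ : U →ₗ[F] (LinearMap.range S →ₗ[F] LinearMap.range S) :=
    { toFun := fun u => P ∘ₗ (T u) ∘ₗ s
      map_add' := by intro a b; ext x; simp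
      map_smul' := by intro a b; ext x; simp }
  have hΦ : ∀ u ∈ LinearMap.ker Φ, ∀ y, P (T u (s y)) = 0 := fun u hu y =>
    LinearMap.congr_fun (LinearMap.mem_ker.1 hu) y
  have key : ∀ u ∈ LinearMap.ker Φ, ∀ x ∈ LinearMap.ker S,
      T u x = (P (T u x) : W) + T u (s (P (T u x))) := by
    intro u hu x hx
    have hM : ∀ y, P (T (u0 + u) (s y)) = y := by
      intro y
      rw [map_add, LinearMap.add_apply, map_add, hΦ u hu, add_zero, ← hS, hs', hP']
    have hinj : Function.Injective (T (u0 + u) ∘ₗ s) := fun a b hab => by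
      rw [← hM a, ← hM b]; exact congrArg P hab
    have h1 : LinearMap.range (T (u0 + u) ∘ₗ s) = LinearMap.range (T (u0 + u)) := by
      apply Submodule.eq_of_le_of_finrank_le (LinearMap.range_comp_le_range _ _)
      rw [LinearMap.finrank_range_of_inj hinj]
      exact hu0 _
    have h2 : T (u0 + u) x ∈ LinearMap.range (T (u0 + u) ∘ₗ s) := h1 ▸ ⟨x, rfl⟩
    obtain ⟨y, hy⟩ := h2
    have hx0 : T (u0 + u) x = T u x := by
      rw [map_add, LinearMap.add_apply, ← hS, LinearMap.mem_ker.1 hx, zero_add]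
    have hy2 : P (T u x) = y := by
      rw [← hx0, ← hy]; exact hM y
    rw [hy2, ← hx0, ← hy, LinearMap.comp_apply, map_add, LinearMap.add_apply, ← hS, hs']
  have pol : ∀ u ∈ LinearMap.ker Φ, ∀ v ∈ LinearMap.ker Φ, ∀ x ∈ LinearMap.ker S,
      T u (s (P (T v x))) = - T v (s (P (T u x))) := by
    intro u hu v hv x hx
    have h1 := key u hu x hx
    have h2 := key v hv x hx
    have h3 := key _ (add_mem hu hv) x hx
    simp only [map_add, LinearMap.add_apply, Submodule.coe_add] at h3
    have : T u (s (P (T v x))) + T v (s (P (T u x))) =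
      ((P (T u x) : W) + (P (T v x) : W) + (T u (s (P (T u x))) + T v (s (P (T u x))) +
       (T u (s (P (T v x))) + T v (s (P (T v x)))))) - ((P (T u x) : W) + T u (s (P (T u x))))
        - ((P (T v x) : W) + T v (s (P (T v x)))) := by abel
    rw [← h1, ← h2] at this
    rw [eq_neg_iff_add_eq_zero, this]
    rw [sub_sub, sub_eq_zero, h3]
  -- spanning set
  let G : Set (LinearMap.range S) :=
    {y | ∃ v ∈ LinearMap.ker Φ, ∃ x ∈ LinearMap.ker S, y = P (T v x)}
  obtain ⟨b, hbG, hbspan, hbli⟩ := exists_linearIndependent F G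
  have hbfin : b.Finite := hbli.setFinite
  haveI : Fintype b := hbfin.fintype
  have hbcard : Fintype.card b ≤ r := hbli.fintype_card_le_finrank
  choose vv hvv xx hxx hyy using fun y : b => hbG y.2
  let E' : Submodule F W := ⨆ y : b, LinearMap.range (T (vv y) ∘ₗ s)
  have hE' : finrank F E' ≤ r ^ 2 := by
    have h1 : finrank F E' ≤ ∑ y : b, finrank F (LinearMap.range (T (vv y) ∘ₗ s)) := by
      have : ∀ (t : Finset b), finrank F (⨆ y ∈ t, LinearMap.range (T (vv y) ∘ₗ s) : Submodule F W)
          ≤ ∑ y ∈ t, finrank F (LinearMap.range (T (vv y) ∘ₗ s)) := by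
        intro t
        induction t using Finset.induction_on with
        | empty => simp
        | insert a t ha ih =>
          rw [Finset.iSup_insert, Finset.sum_insert ha]
          exact (Submodule.finrank_add_le_finrank_add_finrank _ _).trans (by omega)
      have h := this Finset.univ
      have e : (⨆ y ∈ (Finset.univ : Finset b), LinearMap.range (T (vv y) ∘ₗ s)) = E' :=
        iSup_congr fun y => iSup_pos (Finset.mem_univ y)
      rwa [e] at h
    have h2 : ∑ y : b, finrank F (LinearMap.range (T (vv y) ∘ₗ s)) ≤ ∑ y : b, r :=
      Finset.sum_le_sum fun y _ => LinearMap.finrank_range_le _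
    have h3 : ∑ y : b, r = Fintype.card b * r := by simp
    rw [h3] at h2
    calc _ ≤ _ := h1
      _ ≤ _ := h2
      _ ≤ r * r := Nat.mul_le_mul_right _ hbcard
      _ = _ := (sq r).symm
  have hmem : ∀ u ∈ LinearMap.ker Φ, ∀ y ∈ Submodule.span F G, T u (s y) ∈ E' := by
    intro u hu
    have : Submodule.span F b ≤ E'.comap (T u ∘ₗ s) := by
      rw [Submodule.span_le]
      intro y hy
      change T u (s y) ∈ E'
      have e : y = P (T (vv ⟨y, hy⟩) (xx ⟨y, hy⟩)) := hyy ⟨y, hy⟩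
      rw [e, pol u hu _ (hvv ⟨y, hy⟩) _ (hxx ⟨y, hy⟩)]
      apply neg_mem
      exact Submodule.mem_iSup_of_mem (⟨y, hy⟩ : b) ⟨_, rfl⟩
    intro y hy
    rw [← hbspan] at hy
    exact this hy
  refine ⟨LinearMap.ker Φ, LinearMap.ker S, LinearMap.range S ⊔ E', ?_, ?_, ?_, ?_⟩
  · have h1 := LinearMap.finrank_range_add_finrank_ker Φ
    have h2 := Submodule.finrank_le (LinearMap.range Φ)
    rw [Module.finrank_linearMap, ← hrdef] at h2
    have h3 : r * r ≤ K ^ 2 := by rw [sq]; exact Nat.mul_le_mul hr hr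
    omega
  · have h1 := LinearMap.finrank_range_add_finrank_ker S
    omega
  · have h1 := Submodule.finrank_add_le_finrank_add_finrank (LinearMap.range S) E'
    have h3 : r ^ 2 ≤ K ^ 2 := Nat.pow_le_pow_left hr 2
    omega
  · intro u hu x hx
    rw [key u hu x hx]
    apply add_mem
    · exact Submodule.mem_sup_left (P (T u x)).2
    · exact Submodule.mem_sup_right (hmem u hu _ (Submodule.subset_span ⟨u, hu, x, hx, rfl⟩))

open Module in
theorem lrt_step1 {F U V W : Type} [Field F] [AddCommGroup U] [AddCommGroup V] [AddCommGroup W]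
    [Module F U] [Module F V] [Module F W] [Finite U]
    [FiniteDimensional F W] (T : U →ₗ[F] V →ₗ[F] W) (k m : ℕ)
    (hm : Nat.card U < m * Nat.card {u : U | finrank F (LinearMap.range (T u)) ≤ k}) :
    ∀ u ∈ Submodule.span F {u : U | finrank F (LinearMap.range (T u)) ≤ k},
      finrank F (LinearMap.range (T u)) ≤ 3 * k * m := by
  classical
  set f : U → ℕ := fun u => finrank F (LinearMap.range (T u)) with hf
  set A : Set U := {u : U | finrank F (LinearMap.range (T u)) ≤ k} with hA
  have hadd : ∀ a b, f (a + b) ≤ f a + f b := by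
    intro a b
    have h1 : LinearMap.range (T (a + b)) ≤ LinearMap.range (T a) ⊔ LinearMap.range (T b) := by
      rintro _ ⟨x, rfl⟩
      rw [map_add]
      exact Submodule.add_mem_sup ⟨x, rfl⟩ ⟨x, rfl⟩
    exact (Submodule.finrank_mono h1).trans (Submodule.finrank_add_le_finrank_add_finrank _ _)
  have hsmul : ∀ (t : F) a, f (t • a) ≤ f a := by
    intro t a
    apply Submodule.finrank_mono
    rintro _ ⟨x, rfl⟩
    exact ⟨t • x, by simp⟩
  have hpath : ∀ u ∈ Submodule.span F A, ∀ (a : F) (z : U),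
      (∀ t < f z, ∃ y, t < f y ∧ f y ≤ t + k) →
      (∀ t < f (a • u + z), ∃ y, t < f y ∧ f y ≤ t + k) := by
    intro u hu
    induction hu using Submodule.span_induction with
    | mem x hx =>
      intro a z hz t ht
      by_cases h : t < f z
      · exact hz t h
      · refine ⟨_, ht, ?_⟩
        have h1 := hadd (a • x) z
        have h2 := hsmul a x
        have h3 : f x ≤ k := hx
        omega
    | zero => intro a z hz; simpa using hz
    | add x y _ _ hx hy =>
      intro a z hz
      rw [smul_add, add_assoc]
      exact hx a _ (hy a z hz)
    | smul b x _ hx =>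
      intro a z hz
      rw [smul_smul]
      exact hx _ z hz
  intro u hu
  by_contra! hcon
  change 3 * k * m < f u at hcon
  have f0 : f 0 = 0 := by simp [hf]
  have hp := hpath u hu 1 0 (by intro t ht; rw [f0] at ht; omega)
  rw [one_smul, add_zero] at hp
  have hy : ∀ j : Fin m, ∃ y, 3 * k * j < f y ∧ f y ≤ 3 * k * j + k := fun j => by
    apply hp
    exact lt_of_le_of_lt (Nat.mul_le_mul_left _ j.2.le) hcon
  choose y hy1 hy2 using hy
  have sep : ∀ i j : Fin m, i < j → ∀ a ∈ A, ∀ b ∈ A, y i + a ≠ y j + b := by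
    intro i j hij a ha b hb h
    have e : y j = y i + (a + (-1 : F) • b) := by
      rw [neg_one_smul, ← add_assoc, h]; abel
    have h1 := hadd (y i) (a + (-1 : F) • b)
    have h2 := hadd a ((-1 : F) • b)
    have h3 := hsmul (-1) b
    have h4 : f a ≤ k := ha
    have h5 : f b ≤ k := hb
    rw [← e] at h1
    have h6 := hy1 j
    have h7 := hy2 i
    have h8 : 3 * k * (i + 1) ≤ 3 * k * j := Nat.mul_le_mul_left _ hij
    rw [mul_add] at h8
    omega
  have hinj : Function.Injective (fun q : Fin m × A => y q.1 + (q.2 : U)) := by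
    rintro ⟨i, a⟩ ⟨j, b⟩ h
    simp only at h
    rcases lt_trichotomy i j with hij | hij | hij
    · exact absurd h (sep i j hij a a.2 b b.2)
    · subst hij
      have := add_left_cancel h
      rw [Subtype.ext this]
    · exact absurd h.symm (sep j i hij b b.2 a a.2)
  have := Nat.card_le_card_of_injective _ hinj
  rw [Nat.card_prod, Nat.card_fin] at this
  exact absurd hm (not_lt.2 this)

/-- **Structure of low-rank trilinear forms.** Let `T : U → L(V, W)` be linear with
`rank T(u) ≤ k` for at least `c|U|` elements `u ∈ U`. Then, with
`ξ = C (1 + log c⁻¹)^C' (1 + k)^C' (1 + log p)^C'`, there are subspaces `U' ≤ U`, `V' ≤ V`,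
`E ≤ W` with `codim U', codim V' ≤ exp(exp ξ)`, `dim E ≤ exp(exp(exp ξ))`, and
`T(u)(v) ∈ E` for all `u ∈ U'`, `v ∈ V'`. -/
theorem low_rank_trilinear_structure :
    ∃ C C' : ℝ, 0 < C ∧ 0 < C' ∧
      ∀ (p : ℕ) (_ : Fact p.Prime)
        (U V W : Type) (_ : AddCommGroup U) (_ : AddCommGroup V) (_ : AddCommGroup W)
        (_ : Module (ZMod p) U) (_ : Module (ZMod p) V) (_ : Module (ZMod p) W)
        (_ : FiniteDimensional (ZMod p) U) (_ : FiniteDimensional (ZMod p) V)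
        (_ : FiniteDimensional (ZMod p) W)
        (T : U →ₗ[ZMod p] (V →ₗ[ZMod p] W)) (c : ℝ) (k : ℕ),
        0 < c →
        c * (Nat.card U : ℝ) ≤
          (Nat.card {u : U | Module.finrank (ZMod p) (LinearMap.range (T u)) ≤ k} : ℝ) →
        ∃ (U' : Submodule (ZMod p) U) (V' : Submodule (ZMod p) V) (E : Submodule (ZMod p) W),
          ((Module.finrank (ZMod p) U - Module.finrank (ZMod p) U' : ℕ) : ℝ) ≤
            Real.exp (Real.exp
              (C * (1 + Real.log c⁻¹) ^ C' * ((1 + k : ℝ)) ^ C' * (1 + Real.log p) ^ C')) ∧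
          ((Module.finrank (ZMod p) V - Module.finrank (ZMod p) V' : ℕ) : ℝ) ≤
            Real.exp (Real.exp
              (C * (1 + Real.log c⁻¹) ^ C' * ((1 + k : ℝ)) ^ C' * (1 + Real.log p) ^ C')) ∧
          ((Module.finrank (ZMod p) E : ℕ) : ℝ) ≤
            Real.exp (Real.exp (Real.exp
              (C * (1 + Real.log c⁻¹) ^ C' * ((1 + k : ℝ)) ^ C' * (1 + Real.log p) ^ C'))) ∧
          ∀ u ∈ U', ∀ v ∈ V', T u v ∈ E := by
  refine ⟨4, 1, by norm_num, by norm_num, ?_⟩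
  intro p hp U V W _ _ _ _ _ _ _ _ _ T c k hc hcard
  haveI : Finite U := Module.finite_of_finite (ZMod p)
  set A : Set U := {u : U | Module.finrank (ZMod p) (LinearMap.range (T u)) ≤ k} with hA
  have hUpos : 0 < (Nat.card U : ℝ) := by exact_mod_cast Nat.card_pos
  have hAU : (Nat.card A : ℝ) ≤ Nat.card U := by
    exact_mod_cast Nat.card_le_card_of_injective _ Subtype.val_injective
  have hc1 : c ≤ 1 := by
    by_contra! h
    nlinarith
  have hci : 1 ≤ c⁻¹ := (one_le_inv₀ hc).2 hc1
  set m : ℕ := ⌊c⁻¹⌋₊ + 1 with hm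
  have hm1 : c⁻¹ < m := by rw [hm]; exact_mod_cast Nat.lt_floor_add_one _
  have hm2 : (m : ℝ) ≤ 2 * c⁻¹ := by
    have := Nat.floor_le (by positivity : 0 ≤ c⁻¹)
    rw [hm]; push_cast; linarith
  have hmc : 1 < m * c := by
    have := mul_lt_mul_of_pos_right hm1 hc
    rwa [inv_mul_cancel₀ hc.ne'] at this
  have hlt : Nat.card U < m * Nat.card A := by
    have : (Nat.card U : ℝ) < m * Nat.card A := by
      have h1 : (m : ℝ) * (c * Nat.card U) ≤ m * Nat.card A :=
        mul_le_mul_of_nonneg_left hcard (by positivity)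
      nlinarith
    exact_mod_cast this
  have hrank := lrt_step1 T k m hlt
  set H := Submodule.span (ZMod p) A with hH
  obtain ⟨U', V', E, hU', hV', hE, hTE⟩ := lrt_step2 (T ∘ₗ H.subtype) (3 * k * m)
    (fun u => hrank u u.2)
  have hcod : ((Module.finrank (ZMod p) U - Module.finrank (ZMod p) H : ℕ) : ℝ) ≤ c⁻¹ := by
    have hle : Module.finrank (ZMod p) H ≤ Module.finrank (ZMod p) U := Submodule.finrank_le H
    have hAH : Nat.card A ≤ Nat.card H :=
      Nat.card_le_card_of_injective (fun a : A => (⟨a, Submodule.subset_span a.2⟩ : H))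
        (fun a b h => by simpa [Subtype.ext_iff] using h)
    have h1 : Nat.card H = p ^ Module.finrank (ZMod p) H := by
      rw [Module.natCard_eq_pow_finrank (K := ZMod p), Nat.card_zmod]
    have h2 : Nat.card U = p ^ Module.finrank (ZMod p) U := by
      rw [Module.natCard_eq_pow_finrank (K := ZMod p), Nat.card_zmod]
    obtain ⟨d, hd⟩ := Nat.exists_eq_add_of_le hle
    rw [hd, pow_add, ← h1] at h2
    rw [hd, Nat.add_sub_cancel_left]
    have hHpos : 0 < (Nat.card H : ℝ) := by exact_mod_cast Nat.card_pos
    have h3 : c * ((Nat.card H : ℝ) * (p : ℝ) ^ d) ≤ Nat.card H := by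
      have : (Nat.card A : ℝ) ≤ Nat.card H := by exact_mod_cast hAH
      rw [h2] at hcard; push_cast at hcard; linarith
    have h4 : c * (p : ℝ) ^ d ≤ 1 := by
      by_contra! h
      nlinarith
    have h5 : (d : ℝ) ≤ (p : ℝ) ^ d := by
      exact_mod_cast (Nat.lt_pow_self hp.out.one_lt).le
    rw [← one_div, le_div_iff₀ hc]
    nlinarith
  set ξ : ℝ := 4 * (1 + Real.log c⁻¹) ^ (1:ℝ) * ((1 + k : ℝ)) ^ (1:ℝ) *
    (1 + Real.log p) ^ (1:ℝ) with hξ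
  have hL : 0 ≤ Real.log c⁻¹ := Real.log_nonneg hci
  have hlp : 0 ≤ Real.log p := Real.log_natCast_nonneg p
  have hk0 : (0:ℝ) ≤ k := Nat.cast_nonneg k
  have hmain : 43 * (1 + (k:ℝ)) ^ 2 * c⁻¹ ^ 2 ≤ Real.exp ξ := by
    have h1 : (4 + 2 * k + 2 * Real.log c⁻¹ : ℝ) ≤ ξ := by
      rw [hξ, Real.rpow_one, Real.rpow_one, Real.rpow_one]
      have ha : (1 + Real.log c⁻¹) * (1 + k : ℝ) ≤
          (1 + Real.log c⁻¹) * (1 + k : ℝ) * (1 + Real.log p) :=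
        le_mul_of_one_le_right (by positivity) (by linarith)
      nlinarith [mul_nonneg hL hk0]
    refine le_trans ?_ (Real.exp_le_exp.2 h1)
    have e : Real.exp (4 + 2 * k + 2 * Real.log c⁻¹) =
        Real.exp 1 ^ 4 * Real.exp k ^ 2 * c⁻¹ ^ 2 := by
      rw [Real.exp_add, Real.exp_add, ← Real.exp_nat_mul, ← Real.exp_nat_mul]
      congr 1
      · norm_num
      · rw [two_mul, Real.exp_add, Real.exp_log (by positivity)]; ring
    rw [e]
    have h43 : (43:ℝ) ≤ Real.exp 1 ^ 4 := by
      have : (2.7:ℝ) ≤ Real.exp 1 := by linarith [Real.exp_one_gt_d9]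
      calc (43:ℝ) ≤ 2.7 ^ 4 := by norm_num
        _ ≤ _ := pow_le_pow_left₀ (by norm_num) this 4
    have hke : 1 + (k:ℝ) ≤ Real.exp k := by linarith [Real.add_one_le_exp (k:ℝ)]
    gcongr
  have hexp : ∀ x : ℝ, x ≤ Real.exp x := fun x => by linarith [Real.add_one_le_exp x]
  have hK : ((3 * k * m : ℕ) : ℝ) ≤ 6 * k * c⁻¹ := by
    push_cast
    nlinarith
  have hK0 : (0:ℝ) ≤ ((3 * k * m : ℕ) : ℝ) := Nat.cast_nonneg _
  have hK2 : ((3 * k * m : ℕ) : ℝ) ^ 2 ≤ 36 * k ^ 2 * c⁻¹ ^ 2 := by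
    calc _ ≤ (6 * k * c⁻¹) ^ 2 := pow_le_pow_left₀ hK0 hK 2
      _ = _ := by ring
  have hkk : (k:ℝ) ≤ (1 + k) ^ 2 := by nlinarith
  have hkk2 : (k:ℝ) ^ 2 ≤ (1 + k) ^ 2 := by nlinarith
  have hcc : c⁻¹ ≤ c⁻¹ ^ 2 := by nlinarith
  have hb1 : c⁻¹ ≤ (1 + (k:ℝ)) ^ 2 * c⁻¹ ^ 2 :=
    hcc.trans (le_mul_of_one_le_left (by positivity) (by nlinarith))
  have hb2 : (k:ℝ) * c⁻¹ ≤ (1 + (k:ℝ)) ^ 2 * c⁻¹ ^ 2 :=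
    mul_le_mul hkk hcc (by positivity) (by positivity)
  have hb3 : (k:ℝ) ^ 2 * c⁻¹ ^ 2 ≤ (1 + (k:ℝ)) ^ 2 * c⁻¹ ^ 2 :=
    mul_le_mul_of_nonneg_right hkk2 (by positivity)
  have hall : c⁻¹ + ((3 * k * m : ℕ) : ℝ) + ((3 * k * m : ℕ) : ℝ) ^ 2 ≤ Real.exp ξ := by
    linarith
  have hc0 : 0 < c⁻¹ := by positivity
  have hsq : 0 ≤ ((3 * k * m : ℕ) : ℝ) ^ 2 := by positivity
  refine ⟨U'.map H.subtype, V', E, ?_, ?_, ?_, ?_⟩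
  · refine le_trans ?_ ((hall.trans (hexp _)))
    rw [Submodule.finrank_map_subtype_eq]
    have : Module.finrank (ZMod p) U - Module.finrank (ZMod p) U' ≤
        (Module.finrank (ZMod p) U - Module.finrank (ZMod p) H) + (3 * k * m) ^ 2 := by omega
    have h2 : ((Module.finrank (ZMod p) U - Module.finrank (ZMod p) U' : ℕ) : ℝ) ≤
        ((Module.finrank (ZMod p) U - Module.finrank (ZMod p) H : ℕ) : ℝ)
          + ((3 * k * m : ℕ) : ℝ) ^ 2 := by exact_mod_cast this
    linarith
  · refine le_trans ?_ ((hall.trans (hexp _)))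
    have : Module.finrank (ZMod p) V - Module.finrank (ZMod p) V' ≤ 3 * k * m := by omega
    have h2 : ((Module.finrank (ZMod p) V - Module.finrank (ZMod p) V' : ℕ) : ℝ) ≤
        ((3 * k * m : ℕ) : ℝ) := by exact_mod_cast this
    linarith
  · refine le_trans ?_ ((hall.trans (hexp _)).trans (hexp _))
    have h2 : ((Module.finrank (ZMod p) E : ℕ) : ℝ) ≤
        ((3 * k * m : ℕ) : ℝ) + ((3 * k * m : ℕ) : ℝ) ^ 2 := by exact_mod_cast hE
    linarith
  · rintro _ ⟨u, hu, rfl⟩ v hv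
    exact hTE u hu v hv
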